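/- Let d ≥ 2, k ≥ 1 and let x_1, …, x_k be real numbers with x_i > d + 2 for all i. Then ∑_{n_1,…,n_k ≥ 1} p_d(n_1,…,n_k) / (n_1^{x_1} ⋯ n_k^{x_k}) = ( ∑_{n_1,…,n_k ≥ 1} ∏_{j=1}^{k−1} min(n_j, n_{j+1}) / (n_1^{x_1} ⋯ n_k^{x_k}) )^{d−1}, where p_d(n_1,…,n_k) = ∑ ∏_{r=1}^{d−1} ∏_{j=1}^{k−1} min(v^{(r)}_j, v^{(r)}_{j+1}), the sum being over all (d−1)-tuples of sequences of positive integers (v^{(1)}, …, v^{(d−1)}), each v^{(r)} = (v^{(r)}_1,…,v^{(r)}_k), such that ∏_{r=1}^{d−1} v^{(r)}_i = n_i for every 1 ≤ i ≤ k; both series converge absolutely. In other words, P_{d,k}(x_1,…,x_k) = (V_k(x_1,…,x_k))^{d−1}. -/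

import Mathlib

/-- The number of parallelogram polyominoes of width `k` whose `i`-th column has
height `n i`, namely `∏_{j=1}^{k-1} min (n j) (n (j+1))` (empty product for `k = 1`). -/
def polyominoCount (k : ℕ) (n : Fin k → ℕ+) : ℕ :=
  ∏ j : Fin (k - 1),
    min ((n ⟨j.1, by have := j.2; omega⟩ : ℕ)) ((n ⟨j.1 + 1, by have := j.2; omega⟩ : ℕ))

/-- The number `p_d(n₁,…,n_k)` of parallelogram polyhypercubes of dimension `d` and
width `k` whose `i`-th plateau has volume `n i`:
`p_d(n) = ∑ ∏_{r=1}^{d-1} ∏_{j=1}^{k-1} min (v r j) (v r (j+1))`, the sum being over all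
`(d-1)`-tuples of sequences of positive integers `v` with `∏_r v r i = n i` for all `i`. -/
def polyhypercubeCount (d k : ℕ) (n : Fin k → ℕ+) : ℕ :=
  ∑ v ∈ (Fintype.piFinset fun _ : Fin (d - 1) =>
        Fintype.piFinset fun i => ((n i : ℕ)).divisors).filter
      (fun v => ∀ i, ∏ r, v r i = (n i : ℕ)),
    ∏ r, ∏ j : Fin (k - 1),
      min (v r ⟨j.1, by have := j.2; omega⟩) (v r ⟨j.1 + 1, by have := j.2; omega⟩)

/-- Summand of the Dirichlet generating function `V_k` of parallelogram polyominoes. -/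
noncomputable def VTerm (k : ℕ) (x : Fin k → ℝ) (n : Fin k → ℕ+) : ℝ :=
  (polyominoCount k n : ℝ) / ∏ i, ((n i : ℕ) : ℝ) ^ x i

/-- Summand of the Dirichlet generating function `P_{d,k}` of parallelogram
polyhypercubes of dimension `d`. -/
noncomputable def PdTerm (d k : ℕ) (x : Fin k → ℝ) (n : Fin k → ℕ+) : ℝ :=
  (polyhypercubeCount d k n : ℝ) / ∏ i, ((n i : ℕ) : ℝ) ^ x i

/-- Fubini for finite products: the product of the sums of finitely many nonnegative series
is the sum, over all tuples of indices, of the products of the terms. -/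
theorem hasSum_pi_prod_of_nonneg {ι : Type*} {m : ℕ} {f : Fin m → ι → ℝ} {a : Fin m → ℝ}
    (hf : ∀ r, HasSum (f r) (a r)) (h0 : ∀ r n, 0 ≤ f r n) :
    HasSum (fun w : Fin m → ι => ∏ r, f r (w r)) (∏ r, a r) := by
  induction m with
  | zero => simp [hasSum_unique]
  | succ m ih =>
    have hw := ih (fun r => hf r.succ) (fun r => h0 r.succ)
    have hs := (hf 0).summable.mul_of_nonneg hw.summable (h0 0)
      (fun w => Finset.prod_nonneg fun r _ => h0 r.succ (w r))
    rw [Fin.prod_univ_succ, ← (Fin.consEquiv fun _ => ι).hasSum_iff]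
    simpa [Function.comp_def, Fin.prod_univ_succ, Fin.consEquiv] using (hf 0).mul hw hs

theorem polyominoCount_le_prod (k : ℕ) (n : Fin k → ℕ+) :
    polyominoCount k n ≤ ∏ i, (n i : ℕ) := by
  cases k with
  | zero => simp [polyominoCount]
  | succ k =>
    rw [Fin.prod_univ_castSucc]
    refine le_trans (Finset.prod_le_prod' fun j _ => min_le_left _ _)
      (Nat.le_mul_of_pos_right _ (n (Fin.last k)).pos)

theorem VTerm_nonneg (k : ℕ) (x : Fin k → ℝ) (n : Fin k → ℕ+) : 0 ≤ VTerm k x n := by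
  unfold VTerm
  positivity

theorem VTerm_le_prod (k : ℕ) (x : Fin k → ℝ) (n : Fin k → ℕ+) :
    VTerm k x n ≤ ∏ i, ((n i : ℕ) : ℝ) ^ (1 - x i) := by
  have h : ∏ i, ((n i : ℕ) : ℝ) ^ (1 - x i) =
      ((∏ i, (n i : ℕ) : ℕ) : ℝ) / ∏ i, ((n i : ℕ) : ℝ) ^ x i := by
    rw [Nat.cast_prod, ← Finset.prod_div_distrib]
    refine Finset.prod_congr rfl fun i _ => ?_
    rw [Real.rpow_sub (by exact_mod_cast (n i).pos), Real.rpow_one]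
  rw [h]
  unfold VTerm
  gcongr
  exact polyominoCount_le_prod k n

theorem summable_VTerm (k : ℕ) (x : Fin k → ℝ) (hx : ∀ i, 2 < x i) : Summable (VTerm k x) := by
  have hs (i : Fin k) : Summable fun n : ℕ+ => ((n : ℕ) : ℝ) ^ (1 - x i) :=
    (Real.summable_nat_rpow.mpr (by linarith [hx i])).comp_injective PNat.coe_injective
  exact Summable.of_nonneg_of_le (VTerm_nonneg k x) (VTerm_le_prod k x)
    (hasSum_pi_prod_of_nonneg (fun i => (hs i).hasSum) fun i n => by positivity).summable

theorem prod_VTerm {m k : ℕ} (x : Fin k → ℝ) (w : Fin m → Fin k → ℕ+) :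
    ∏ r, VTerm k x (w r) =
      ((∏ r, polyominoCount k (w r) : ℕ) : ℝ) / ∏ i, ((∏ r, w r i : ℕ+) : ℝ) ^ x i := by
  simp only [VTerm, Finset.prod_div_distrib, Nat.cast_prod]
  congr 1
  rw [Finset.prod_comm]
  refine Finset.prod_congr rfl fun i _ => ?_
  rw [Real.finsetProd_rpow _ _ fun r _ => by positivity]
  simp

/-- Grouping tuples of sequences by their coordinatewise product yields the terms of the
Dirichlet generating function of parallelogram polyhypercubes. -/
theorem tsum_fiber_prod_VTerm (d k : ℕ) (x : Fin k → ℝ) (n : Fin k → ℕ+) :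
    ∑' w : (fun (w : Fin (d - 1) → Fin k → ℕ+) i => ∏ r, w r i) ⁻¹' {n},
      ∏ r, VTerm k x (w.1 r) = PdTerm d k x n := by
  set e : (Fin (d - 1) → Fin k → ℕ+) → Fin (d - 1) → Fin k → ℕ := fun w r i => w r i with he
  have hinj : Function.Injective e := fun w w' h => by
    funext r i
    exact PNat.coe_injective (congrFun (congrFun h r) i)
  set S := (Fintype.piFinset fun _ : Fin (d - 1) =>
        Fintype.piFinset fun i => ((n i : ℕ)).divisors).filter
      (fun v => ∀ i, ∏ r, v r i = (n i : ℕ)) with hS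
  have hfib : (fun (w : Fin (d - 1) → Fin k → ℕ+) i => ∏ r, w r i) ⁻¹' {n} =
      ↑(S.preimage e hinj.injOn) := by
    ext w
    have hw : (fun i => ∏ r, w r i) = n ↔ ∀ i, ∏ r, (w r i : ℕ) = n i := by
      simp only [funext_iff, ← PNat.coe_inj, Finset.PNat.coe_prod]
    simp only [Set.mem_preimage, Set.mem_singleton_iff, Finset.coe_preimage, Finset.mem_coe, hS,
      Finset.mem_filter, Fintype.mem_piFinset, hw, he]
    refine ⟨fun h => ⟨fun r i => Nat.mem_divisors.mpr ⟨?_, (n i).ne_zero⟩, h⟩, fun h => h.2⟩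
    rw [← h i]
    exact Finset.dvd_prod_of_mem (fun r => (w r i : ℕ)) (Finset.mem_univ r)
  rw [hfib, Finset.tsum_subtype' (S.preimage e hinj.injOn) fun w => ∏ r, VTerm k x (w r)]
  unfold PdTerm polyhypercubeCount
  rw [← hS, Nat.cast_sum, Finset.sum_div, ← Finset.sum_preimage e S hinj.injOn]
  · refine Finset.sum_congr rfl fun w hw => ?_
    have hn : (fun i => ∏ r, w r i) = n := by
      have : w ∈ (↑(S.preimage e hinj.injOn) : Set _) := hw
      rwa [← hfib] at this
    rw [prod_VTerm, ← hn]
    rfl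
  · intro v hv hv'
    refine absurd ⟨fun r i => ⟨v r i, ?_⟩, rfl⟩ hv'
    rw [hS, Finset.mem_filter, Fintype.mem_piFinset] at hv
    exact Nat.pos_of_mem_divisors (Fintype.mem_piFinset.mp (hv.1 r) i)

/-- For `d ≥ 2`, `k ≥ 1` and real `x i > d + 2`, the Dirichlet
generating function of parallelogram polyhypercubes of dimension `d` is the `(d-1)`-st
power of that of parallelogram polyominoes: `P_{d,k}(x) = (V_k(x))^{d-1}`, both series
converging absolutely. -/
theorem dirichlet_gf_parallelogram_polyhypercubes_eq_pow
    (d k : ℕ) (hd : 2 ≤ d) (hk : 1 ≤ k) (x : Fin k → ℝ) (hx : ∀ i, (d : ℝ) + 2 < x i) :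
    Summable (PdTerm d k x) ∧ Summable (VTerm k x) ∧
    ∑' n, PdTerm d k x n = (∑' n, VTerm k x n) ^ (d - 1) := by
  have hd' : (2 : ℝ) ≤ d := by exact_mod_cast hd
  have hV : Summable (VTerm k x) := summable_VTerm k x fun i => by linarith [hx i]
  have hprod := (hasSum_pi_prod_of_nonneg (m := d - 1) (fun _ => hV.hasSum)
    fun _ => VTerm_nonneg k x).tsum_fiberwise fun w i => ∏ r, w r i
  simp only [tsum_fiber_prod_VTerm, Finset.prod_const, Finset.card_univ, Fintype.card_fin] at hprod
  exact ⟨hprod.summable, hV, hprod.tsum_eq⟩
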